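/- (Appendix, induction claim (26)) Let d ≥ 2, n = d+1, ℓ ∈ [1:d−1], ℓ₁ ∈ [0:⌊ℓ/2⌋], and write d−ℓ₁ = s(d−ℓ) + r with integers s ≥ 1 and r ∈ [1:d−ℓ]. For any symmetrical code that satisfies node regeneration, and for every p ∈ [1:s], one has p·H(U^{(ℓ₁,ℓ)} | M^{(ℓ)}) + H(U^{(ℓ₁,ℓ₁+1)} | M^{(ℓ)}) ≥ p·H(U^{(ℓ₁,ℓ+1)} | M^{(ℓ)}) + H(W_{[ℓ₁+1:2ℓ₁]}, S_{ℓ+1→[ℓ₁+1:2ℓ₁]}, S_{(∪_{q=0}^{s−p} τ_q)→ℓ+1} | M^{(ℓ)}). -/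

import Mathlib

open scoped BigOperators Classical

namespace MDCSR

noncomputable section

/-- `X` is a deterministic function of `Y`. -/
def IsFuncOf {Ω α β : Type*} (X : Ω → α) (Y : Ω → β) : Prop :=
  ∃ f : β → α, ∀ ω, X ω = f (Y ω)

variable {Ω V : Type} [Fintype Ω]

/-- Probability of the event `X = x` under the probability mass function `p`. -/
def pm (p : Ω → ℝ) {α : Type*} (X : Ω → α) (x : α) : ℝ :=
  ∑ ω ∈ Finset.univ.filter (fun ω' => X ω' = x), p ω

/-- Shannon entropy of the random variable `X` under the probability mass function `p`. -/
def H (p : Ω → ℝ) {α : Type*} (X : Ω → α) : ℝ :=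
  -∑ ω, p ω * Real.log (pm p X (X ω))

/-- An `(n = d+1, d)` code: messages `M 1, …, M d`, a key `K`, node contents
`W 1, …, W (d+1)`, and repair data `S i j` (data downloaded from node `i` to repair
node `j`), all random variables on a common finite probability space `(Ω, p)`.
The messages are mutually independent, the key is independent of the messages,
each `W i` is a deterministic function of the messages and the key, and each
`S i j` is a deterministic function of `W i`. -/
structure Code (Ω V : Type) [Fintype Ω] (d : ℕ) : Type where
  p : Ω → ℝ
  p_nonneg : ∀ ω, 0 ≤ p ω
  p_sum : ∑ ω, p ω = 1
  M : ℕ → Ω → V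
  K : Ω → V
  W : ℕ → Ω → V
  S : ℕ → ℕ → Ω → V
  M_indep : ∀ x : ℕ → V,
    pm p (fun ω (i : Fin d) => M (↑i + 1) ω) (fun i => x (↑i + 1)) =
      ∏ i ∈ Finset.Icc 1 d, pm p (M i) (x i)
  K_indep : ∀ (k : V) (x : ℕ → V),
    pm p (fun ω => (K ω, fun (i : Fin d) => M (↑i + 1) ω)) (k, fun i => x (↑i + 1)) =
      pm p K k * pm p (fun ω (i : Fin d) => M (↑i + 1) ω) (fun i => x (↑i + 1))
  W_func : ∀ i ∈ Finset.Icc 1 (d + 1),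
    IsFuncOf (W i) (fun ω => ((fun (j : Fin d) => M (↑j + 1) ω), K ω))
  S_func : ∀ i ∈ Finset.Icc 1 (d + 1), ∀ j ∈ Finset.Icc 1 (d + 1), i ≠ j →
    IsFuncOf (S i j) (W i)

/-- Descriptors for the basic random variables of a code. -/
inductive Atom where
  | M : ℕ → Atom
  | K : Atom
  | W : ℕ → Atom
  | S : ℕ → ℕ → Atom

variable {d : ℕ}

/-- The random variable described by an atom. -/
def Code.atomRV (C : Code Ω V d) : Atom → Ω → V
  | .M i => C.M i
  | .K => C.K
  | .W i => C.W i
  | .S i j => C.S i j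

/-- The joint random variable (tuple) described by a list of atoms. -/
def Code.rv (C : Code Ω V d) (L : List Atom) : Ω → List V :=
  fun ω => L.map fun a => C.atomRV a ω

/-- Joint entropy of a tuple of basic random variables. -/
def Code.HL (C : Code Ω V d) (L : List Atom) : ℝ := H C.p (C.rv L)

/-- Conditional entropy `H(L₁ | L₂)`. -/
def Code.CH (C : Code Ω V d) (L₁ L₂ : List Atom) : ℝ := C.HL (L₁ ++ L₂) - C.HL L₂

/-- Mutual information `I(L₁ ; L₂)`. -/
def Code.MI (C : Code Ω V d) (L₁ L₂ : List Atom) : ℝ :=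
  C.HL L₁ + C.HL L₂ - C.HL (L₁ ++ L₂)

/-- Relabeling of an atom along a permutation of the storage-node indices. -/
def Atom.perm (π : Equiv.Perm ℕ) : Atom → Atom
  | .M i => .M i
  | .K => .K
  | .W i => .W (π i)
  | .S i j => .S (π i) (π j)

/-- A code is symmetrical if every joint entropy of a tuple of the basic random
variables is invariant under every permutation of the storage-node indices `[1:n]`. -/
def Code.Symmetrical (C : Code Ω V d) : Prop :=
  ∀ π : Equiv.Perm ℕ, (∀ i ∈ Finset.Icc 1 (d + 1), π i ∈ Finset.Icc 1 (d + 1)) →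
    ∀ L : List Atom, C.HL (L.map (Atom.perm π)) = C.HL L

/-- The list `[a, a+1, …, b]`. -/
def icc (a b : ℕ) : List ℕ := List.range' a (b + 1 - a)

/-- `W_A` as a list of atoms. -/
def Ws (A : List ℕ) : List Atom := A.map Atom.W

/-- `M_A` as a list of atoms. -/
def MsL (A : List ℕ) : List Atom := A.map Atom.M

/-- `M^{(m)} = (M_1, …, M_m)`. -/
def Mup (m : ℕ) : List Atom := MsL (icc 1 m)

/-- `S_{B → j}`. -/
def Sto (B : List ℕ) (j : ℕ) : List Atom := B.map fun i => Atom.S i j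

/-- `S_{i → B}`. -/
def Sfrom (i : ℕ) (B : List ℕ) : List Atom := B.map fun j => Atom.S i j

/-- `S̄_{→ j} = S_{[j+1:n] → j}` (here `n = d+1`). -/
def SbarTo (d j : ℕ) : List Atom := Sto (icc (j + 1) (d + 1)) j

/-- `S̄_{→ A}`. -/
def SbarToL (d : ℕ) (A : List ℕ) : List Atom := (A.map (SbarTo d)).flatten

/-- `S̲_{→ j} = S_{[1:j-1] → j}`. -/
def SunderTo (j : ℕ) : List Atom := Sto (icc 1 (j - 1)) j

/-- `S̲_{→ A}`. -/
def SunderToL (A : List ℕ) : List Atom := (A.map SunderTo).flatten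

/-- `S_{→ j} = S_{([1:n] ∖ {j}) → j}` (here `n = d+1`). -/
def StoFull (d j : ℕ) : List Atom := Sto ((icc 1 (d + 1)).filter (fun i => i ≠ j)) j

/-- `(S_{→ j} : j ∈ A)`. -/
def StoFullL (d : ℕ) (A : List ℕ) : List Atom := (A.map (StoFull d)).flatten

/-- `U^{(t,s)} = (W_{[1:t]}, S̄_{→[t+1:s]})`. -/
def U (d t s : ℕ) : List Atom := Ws (icc 1 t) ++ SbarToL d (icc (t + 1) s)

/-- Node regeneration: each `W j` is a deterministic function of `S_{→ j}`. -/
def Code.NodeRegen (C : Code Ω V d) : Prop :=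
  ∀ j ∈ Finset.Icc 1 (d + 1), IsFuncOf (C.W j) (C.rv (StoFull d j))

/-- Message recovery for parameter `ℓ`: `M j` is constant for `j ∈ [1:ℓ]`, and for every
`A ⊆ [1:n]` with `|A| ∈ [ℓ+1:d]`, `M_{|A|}` is a deterministic function of `W_A`. -/
def Code.MsgRecovery (C : Code Ω V d) (ℓ : ℕ) : Prop :=
  (∀ j ∈ Finset.Icc 1 ℓ, ∃ c : V, ∀ ω, C.M j ω = c) ∧
  ∀ A : Finset ℕ, A ⊆ Finset.Icc 1 (d + 1) → A.card ∈ Finset.Icc (ℓ + 1) d →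
    IsFuncOf (C.M A.card) (C.rv (Ws (A.sort (· ≤ ·))))

/-- Repair secrecy for parameters `ℓ₁, ℓ₂`: for all disjoint `E₁, E₂ ⊆ [1:n]` with
`|E₁| = ℓ₁`, `|E₂| = ℓ₂`, the messages `M_{ℓ+1}, …, M_d` are independent of
`((W_i : i ∈ E₁), (S_{→j} : j ∈ E₂))`, where `ℓ = ℓ₁ + ℓ₂`. -/
def Code.RepairSecrecy (C : Code Ω V d) (ℓ₁ ℓ₂ : ℕ) : Prop :=
  ∀ E₁ E₂ : Finset ℕ, E₁ ⊆ Finset.Icc 1 (d + 1) → E₂ ⊆ Finset.Icc 1 (d + 1) →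
    Disjoint E₁ E₂ → E₁.card = ℓ₁ → E₂.card = ℓ₂ →
    C.MI (MsL (icc (ℓ₁ + ℓ₂ + 1) d))
      (Ws (E₁.sort (· ≤ ·)) ++ StoFullL d (E₂.sort (· ≤ ·))) = 0

/-- `T_{d,k,ℓ} = Σ_{t=ℓ+1}^{k} (d+1−t)`, as a real number. -/
def T (d k ℓ : ℕ) : ℝ := ∑ t ∈ Finset.Icc (ℓ + 1) k, ((d : ℝ) + 1 - (t : ℝ))


/-- The relabeling `a_t` from the appendix. -/
def aIdx (ℓ ℓ₁ t : ℕ) : ℕ :=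
  if t ≤ ℓ₁ then t else if t ≤ ℓ - ℓ₁ then t + ℓ₁ else t + ℓ₁ + 1

/-- The index set `τ_q` from the appendix, as a list. -/
def tauL (d ℓ ℓ₁ r q : ℕ) : List ℕ :=
  if q = 0 then (icc 1 r).map (aIdx ℓ ℓ₁)
  else (icc (r + 1 + (q - 1) * (d - ℓ)) (r + q * (d - ℓ))).map (aIdx ℓ ℓ₁)

/-! ### Entropy inequalities -/

lemma le_pm {p : Ω → ℝ} (hp : ∀ ω, 0 ≤ p ω) {α : Type*} (X : Ω → α) (ω : Ω) :
    p ω ≤ pm p X (X ω) :=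
  Finset.single_le_sum (f := p) (fun i _ => hp i) (by simp)

/-- Entropy is monotone under functional dependence. -/
lemma H_le_of_determines {p : Ω → ℝ} (hp : ∀ ω, 0 ≤ p ω) {α β : Type*} {X : Ω → α} {Y : Ω → β}
    (h : ∀ ω ω', Y ω = Y ω' → X ω = X ω') : H p X ≤ H p Y := by
  unfold H
  refine neg_le_neg (Finset.sum_le_sum fun ω _ => ?_)
  rcases (hp ω).eq_or_lt with h0 | h0
  · simp [← h0]
  · refine mul_le_mul_of_nonneg_left (Real.log_le_log (h0.trans_le (le_pm hp Y ω)) ?_) h0.le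
    refine Finset.sum_le_sum_of_subset_of_nonneg (fun ω' hω' => ?_) (fun i _ _ => hp i)
    simp only [Finset.mem_filter, Finset.mem_univ, true_and] at hω' ⊢
    exact h _ _ hω'

lemma sum_weight_div_pm_le {p : Ω → ℝ} (hp : ∀ ω, 0 ≤ p ω) {α β γ : Type*}
    {X : Ω → α} {Y : Ω → β} {Z : Ω → γ}
    (hX : ∀ ω ω', X ω = X ω' → Z ω = Z ω') (hY : ∀ ω ω', Y ω = Y ω' → Z ω = Z ω') :
    ∑ ω, p ω * (pm p X (X ω) * pm p Y (Y ω) /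
      (pm p (fun ω => (X ω, Y ω)) (X ω, Y ω) * pm p Z (Z ω))) ≤ ∑ ω, p ω := by
  set q : Ω → ℝ := fun ω => pm p (fun ω => (X ω, Y ω)) (X ω, Y ω) with hq
  have hpm : ∀ {δ : Type _} (T : Ω → δ) (t : δ), 0 ≤ pm p T t :=
    fun T t => Finset.sum_nonneg fun i _ => hp i
  have expand : ∀ ω, p ω * (pm p X (X ω) * pm p Y (Y ω) / (q ω * pm p Z (Z ω))) =
      ∑ a, ∑ b, (if X a = X ω ∧ Y b = Y ω then
        p a * p b * (p ω / (q ω * pm p Z (Z ω))) else 0) := by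
    intro ω
    have hx : pm p X (X ω) = ∑ a, if X a = X ω then p a else 0 := by
      simp [pm, Finset.sum_filter]
    have hy : pm p Y (Y ω) = ∑ b, if Y b = Y ω then p b else 0 := by
      simp [pm, Finset.sum_filter]
    rw [hx, hy, Finset.sum_mul_sum, Finset.sum_div, Finset.mul_sum]
    refine Finset.sum_congr rfl fun a _ => ?_
    rw [Finset.sum_div, Finset.mul_sum]
    refine Finset.sum_congr rfl fun b _ => ?_
    by_cases h1 : X a = X ω <;> by_cases h2 : Y b = Y ω <;> simp [h1, h2]
    ring
  have inner : ∀ a b, ∑ ω, (if X a = X ω ∧ Y b = Y ω then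
        p a * p b * (p ω / (q ω * pm p Z (Z ω))) else 0) ≤
      if Z b = Z a then p a * p b / pm p Z (Z a) else 0 := by
    intro a b
    have hrhs : 0 ≤ if Z b = Z a then p a * p b / pm p Z (Z a) else 0 := by
      split_ifs
      · exact div_nonneg (mul_nonneg (hp a) (hp b)) (hpm _ _)
      · exact le_rfl
    by_cases hne : ∃ ω₀, X a = X ω₀ ∧ Y b = Y ω₀
    · obtain ⟨ω₀, h1, h2⟩ := hne
      have hza : Z a = Z ω₀ := hX _ _ h1
      have hzb : Z b = Z ω₀ := hY _ _ h2
      have hterm : ∀ ω, (if X a = X ω ∧ Y b = Y ω then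
          p a * p b * (p ω / (q ω * pm p Z (Z ω))) else 0) =
          (if X ω = X ω₀ ∧ Y ω = Y ω₀ then p ω else 0) *
            (p a * p b / pm p Z (Z a) / q ω₀) := by
        intro ω
        by_cases hc : X ω = X ω₀ ∧ Y ω = Y ω₀
        · have hqe : q ω = q ω₀ := by simp only [hq, hc.1, hc.2]
          have hze : Z ω = Z a := (hX _ _ hc.1).trans hza.symm
          rw [if_pos hc, if_pos ⟨h1.trans hc.1.symm, h2.trans hc.2.symm⟩, hqe, hze,
            div_div, mul_comm (q ω₀)]
          ring
        · rw [if_neg hc, if_neg, zero_mul]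
          rintro ⟨h3, h4⟩
          exact hc ⟨h3.symm.trans h1, h4.symm.trans h2⟩
      have hqs : ∑ ω, (if X ω = X ω₀ ∧ Y ω = Y ω₀ then p ω else 0) = q ω₀ := by
        simp [hq, pm, Finset.sum_filter]
      rw [Finset.sum_congr rfl fun ω _ => hterm ω, ← Finset.sum_mul, hqs,
        if_pos (hzb.trans hza.symm)]
      rw [if_pos (hzb.trans hza.symm)] at hrhs
      by_cases h0 : q ω₀ = 0
      · simpa [h0] using hrhs
      · rw [mul_div_cancel₀ _ h0]
    · rw [Finset.sum_eq_zero]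
      · exact hrhs
      · intro ω _
        rw [if_neg fun h => hne ⟨ω, h⟩]
  calc _ = ∑ a, ∑ b, ∑ ω, (if X a = X ω ∧ Y b = Y ω then
        p a * p b * (p ω / (q ω * pm p Z (Z ω))) else 0) := by
        rw [Finset.sum_congr rfl fun ω _ => expand ω, Finset.sum_comm]
        exact Finset.sum_congr rfl fun a _ => Finset.sum_comm
    _ ≤ ∑ a, ∑ b, if Z b = Z a then p a * p b / pm p Z (Z a) else 0 :=
        Finset.sum_le_sum fun a _ => Finset.sum_le_sum fun b _ => inner a b
    _ ≤ ∑ a, p a := by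
        refine Finset.sum_le_sum fun a _ => ?_
        have : ∑ b, (if Z b = Z a then p a * p b / pm p Z (Z a) else 0) =
            p a / pm p Z (Z a) * pm p Z (Z a) := by
          rw [← Finset.sum_filter]
          conv_rhs => enter [2]; rw [pm]
          rw [Finset.mul_sum]
          exact Finset.sum_congr rfl fun b _ => by ring
        rw [this]
        by_cases h0 : pm p Z (Z a) = 0
        · simpa [h0] using hp a
        · rw [div_mul_cancel₀ _ h0]

/-- Submodularity of entropy: if `Z` is determined by `X` and by `Y`, then
`H(X) + H(Y) ≥ H(X, Y) + H(Z)`. -/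
lemma H_pair_add_le {p : Ω → ℝ} (hp : ∀ ω, 0 ≤ p ω) {α β γ : Type*}
    {X : Ω → α} {Y : Ω → β} {Z : Ω → γ}
    (hX : ∀ ω ω', X ω = X ω' → Z ω = Z ω') (hY : ∀ ω ω', Y ω = Y ω' → Z ω = Z ω') :
    H p (fun ω => (X ω, Y ω)) + H p Z ≤ H p X + H p Y := by
  have key := sum_weight_div_pm_le hp hX hY
  have hle : ∑ ω, (p ω - p ω * (pm p X (X ω) * pm p Y (Y ω) /
      (pm p (fun ω => (X ω, Y ω)) (X ω, Y ω) * pm p Z (Z ω)))) ≤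
      ∑ ω, (p ω * Real.log (pm p (fun ω => (X ω, Y ω)) (X ω, Y ω)) +
        p ω * Real.log (pm p Z (Z ω)) - p ω * Real.log (pm p X (X ω)) -
        p ω * Real.log (pm p Y (Y ω))) := by
    refine Finset.sum_le_sum fun ω _ => ?_
    rcases (hp ω).eq_or_lt with h0 | h0
    · simp [← h0]
    have h1 := h0.trans_le (le_pm hp X ω)
    have h2 := h0.trans_le (le_pm hp Y ω)
    have h3 := h0.trans_le (le_pm hp Z ω)
    have h4 := h0.trans_le (le_pm hp (fun ω => (X ω, Y ω)) ω)
    have hlog := Real.log_le_sub_one_of_pos (div_pos (mul_pos h1 h2) (mul_pos h4 h3))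
    rw [Real.log_div (by positivity) (by positivity), Real.log_mul h1.ne' h2.ne',
      Real.log_mul h4.ne' h3.ne'] at hlog
    have := mul_le_mul_of_nonneg_left hlog h0.le
    linarith
  simp only [Finset.sum_add_distrib, Finset.sum_sub_distrib] at hle
  unfold H
  linarith

/-- Submodularity of entropy, with the joint variable replaced by any `T` that it determines. -/
lemma H_add_le_of_determines {p : Ω → ℝ} (hp : ∀ ω, 0 ≤ p ω) {α β γ δ : Type*}
    {X : Ω → α} {Y : Ω → β} {T : Ω → δ} {Z : Ω → γ}
    (hT : ∀ ω ω', X ω = X ω' → Y ω = Y ω' → T ω = T ω')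
    (hX : ∀ ω ω', X ω = X ω' → Z ω = Z ω') (hY : ∀ ω ω', Y ω = Y ω' → Z ω = Z ω') :
    H p T + H p Z ≤ H p X + H p Y := by
  have h1 := H_pair_add_le hp hX hY
  have h2 : H p T ≤ H p (fun ω => (X ω, Y ω)) :=
    H_le_of_determines hp fun ω ω' h => hT ω ω' (congrArg Prod.fst h) (congrArg Prod.snd h)
  linarith

/-! ### Determination between tuples of code variables -/

/-- The atom `a` takes the same value at the outcomes `ω` and `ω'`. -/
def Code.Agree (C : Code Ω V d) (ω ω' : Ω) (a : Atom) : Prop := C.atomRV a ω = C.atomRV a ω'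

lemma Code.rv_eq_iff (C : Code Ω V d) (L : List Atom) (ω ω' : Ω) :
    C.rv L ω = C.rv L ω' ↔ ∀ a ∈ L, C.Agree ω ω' a := by
  simp [Code.rv, Code.Agree]

lemma Code.HL_le (C : Code Ω V d) {L L' : List Atom}
    (h : ∀ ω ω', (∀ a ∈ L', C.Agree ω ω' a) → ∀ a ∈ L, C.Agree ω ω' a) : C.HL L ≤ C.HL L' :=
  H_le_of_determines C.p_nonneg fun ω ω' e =>
    (C.rv_eq_iff _ _ _).2 (h ω ω' ((C.rv_eq_iff _ _ _).1 e))

lemma Code.HL_add_le (C : Code Ω V d) {L₁ L₂ T Z : List Atom}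
    (hT : ∀ ω ω', (∀ a ∈ L₁, C.Agree ω ω' a) → (∀ a ∈ L₂, C.Agree ω ω' a) →
      ∀ a ∈ T, C.Agree ω ω' a)
    (h₁ : ∀ ω ω', (∀ a ∈ L₁, C.Agree ω ω' a) → ∀ a ∈ Z, C.Agree ω ω' a)
    (h₂ : ∀ ω ω', (∀ a ∈ L₂, C.Agree ω ω' a) → ∀ a ∈ Z, C.Agree ω ω' a) :
    C.HL T + C.HL Z ≤ C.HL L₁ + C.HL L₂ := by
  refine H_add_le_of_determines C.p_nonneg ?_ ?_ ?_
  · intro ω ω' e e'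
    rw [Code.rv_eq_iff] at *
    exact hT ω ω' e e'
  · intro ω ω' e
    rw [Code.rv_eq_iff] at *
    exact h₁ ω ω' e
  · intro ω ω' e
    rw [Code.rv_eq_iff] at *
    exact h₂ ω ω' e

lemma mem_icc {a b x : ℕ} : x ∈ icc a b ↔ a ≤ x ∧ x ≤ b := by
  simp only [icc, List.mem_range'_1]
  omega

lemma Code.agree_S (C : Code Ω V d) {ω ω' : Ω} {i j : ℕ} (hi : i ∈ Finset.Icc 1 (d + 1))
    (hj : j ∈ Finset.Icc 1 (d + 1)) (hij : i ≠ j) (h : C.Agree ω ω' (.W i)) :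
    C.Agree ω ω' (.S i j) := by
  obtain ⟨f, hf⟩ := C.S_func i hi j hj hij
  have h' : C.W i ω = C.W i ω' := h
  simp only [Code.Agree, Code.atomRV, hf, h']

lemma Code.NodeRegen.agree_W {C : Code Ω V d} (hC : C.NodeRegen) {ω ω' : Ω} {j : ℕ}
    (hj : j ∈ Finset.Icc 1 (d + 1))
    (h : ∀ i ∈ Finset.Icc 1 (d + 1), i ≠ j → C.Agree ω ω' (.S i j)) :
    C.Agree ω ω' (.W j) := by
  obtain ⟨f, hf⟩ := hC j hj
  have : C.rv (StoFull d j) ω = C.rv (StoFull d j) ω' := by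
    rw [Code.rv_eq_iff]
    intro a ha
    simp only [StoFull, Sto, List.mem_map, List.mem_filter, mem_icc, decide_eq_true_eq] at ha
    obtain ⟨i, ⟨hi, hij⟩, rfl⟩ := ha
    exact h i (Finset.mem_Icc.2 hi) hij
  simp only [Code.Agree, Code.atomRV, hf, this]

lemma mem_U {d t s : ℕ} {a : Atom} :
    a ∈ U d t s ↔ (∃ i, (1 ≤ i ∧ i ≤ t) ∧ .W i = a) ∨
      ∃ j, (t + 1 ≤ j ∧ j ≤ s) ∧ ∃ i, (j + 1 ≤ i ∧ i ≤ d + 1) ∧ .S i j = a := by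
  simp [U, Ws, SbarToL, SbarTo, Sto, mem_icc]

/-- `U^{(t,s)}` determines `W_1, …, W_s`. -/
lemma Code.NodeRegen.agree_W_of_U {C : Code Ω V d} (hC : C.NodeRegen) {ω ω' : Ω} {t s : ℕ}
    (hs : s ≤ d + 1) (h : ∀ a ∈ U d t s, C.Agree ω ω' a) {j : ℕ} (hj : 1 ≤ j) (hjs : j ≤ s) :
    C.Agree ω ω' (.W j) := by
  induction j using Nat.strong_induction_on with
  | _ j ih =>
    rcases le_or_gt j t with hjt | hjt
    · exact h _ (mem_U.2 (.inl ⟨j, ⟨hj, hjt⟩, rfl⟩))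
    · refine hC.agree_W (Finset.mem_Icc.2 ⟨hj, by omega⟩) fun i hi hij => ?_
      have hi' := Finset.mem_Icc.1 hi
      rcases lt_or_gt_of_ne hij with hlt | hgt
      · exact C.agree_S hi (Finset.mem_Icc.2 ⟨hj, by omega⟩) hij (ih i hlt hi'.1 (by omega))
      · exact h _ (mem_U.2 (.inr ⟨j, ⟨hjt, hjs⟩, i, ⟨hgt, hi'.2⟩, rfl⟩))

/-! ### Relabelling of storage nodes -/

/-- A partial bijection between subsets of `s` extends to a permutation preserving `s`. -/
lemma exists_perm_extending {ι α : Type*} (s : Finset α) (I : Finset ι) (f g : ι → α)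
    (hf : ∀ i ∈ I, f i ∈ s) (hg : ∀ i ∈ I, g i ∈ s)
    (hfi : Set.InjOn f I) (hgi : Set.InjOn g I) :
    ∃ π : Equiv.Perm α, (∀ x ∈ s, π x ∈ s) ∧ ∀ i ∈ I, π (f i) = g i := by
  induction I using Finset.induction_on with
  | empty => exact ⟨1, by simp, by simp⟩
  | insert a I ha ih =>
    obtain ⟨π, hπ, hfg⟩ := ih (fun i hi => hf i (Finset.mem_insert_of_mem hi))
      (fun i hi => hg i (Finset.mem_insert_of_mem hi))
      (hfi.mono (by simp)) (hgi.mono (by simp))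
    refine ⟨Equiv.swap (π (f a)) (g a) * π, fun x hx => ?_, fun i hi => ?_⟩
    · rw [Equiv.Perm.mul_apply, Equiv.swap_apply_def]
      split_ifs
      · exact hg a (Finset.mem_insert_self _ _)
      · exact hπ _ (hf a (Finset.mem_insert_self _ _))
      · exact hπ _ hx
    · rw [Equiv.Perm.mul_apply]
      rcases Finset.mem_insert.1 hi with rfl | hi'
      · simp
      · have hne : i ≠ a := fun h => ha (h ▸ hi')
        rw [hfg i hi', Equiv.swap_apply_of_ne_of_ne]
        · rw [← hfg i hi']
          exact fun h => hne (hfi (by simp [hi']) (by simp) (π.injective h))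
        · exact fun h => hne (hgi (by simp [hi']) (by simp) h)

lemma aIdx_strictMono (ℓ ℓ₁ : ℕ) : StrictMono (aIdx ℓ ℓ₁) := by
  intro x y hxy
  unfold aIdx
  split_ifs <;> omega

lemma aIdx_ne (ℓ ℓ₁ t : ℕ) (h : 2 * ℓ₁ ≤ ℓ) : aIdx ℓ ℓ₁ t ≠ ℓ + 1 := by
  unfold aIdx
  split_ifs <;> omega

lemma aIdx_notMem (ℓ ℓ₁ t : ℕ) :
    ¬ (ℓ₁ + 1 ≤ aIdx ℓ ℓ₁ t ∧ aIdx ℓ ℓ₁ t ≤ 2 * ℓ₁) := by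
  unfold aIdx
  split_ifs <;> omega

lemma aIdx_mem_Icc {d ℓ ℓ₁ t : ℕ} (h : 2 * ℓ₁ ≤ ℓ) (hℓ : ℓ < d) (ht : 1 ≤ t)
    (ht' : t ≤ d - ℓ₁) : aIdx ℓ ℓ₁ t ∈ Finset.Icc 1 (d + 1) := by
  rw [Finset.mem_Icc]
  unfold aIdx
  split_ifs <;> omega

lemma flatten_tauL (d ℓ ℓ₁ r k : ℕ) :
    ((List.range (k + 1)).map (tauL d ℓ ℓ₁ r)).flatten =
      (icc 1 (r + k * (d - ℓ))).map (aIdx ℓ ℓ₁) := by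
  induction k with
  | zero => simp [tauL]
  | succ k ih =>
    rw [List.range_succ, List.map_append, List.flatten_append, ih]
    simp only [tauL, List.map_cons, List.map_nil, List.flatten_cons, List.flatten_nil,
      List.append_nil, Nat.succ_ne_zero, if_false, ← List.map_append, Nat.add_sub_cancel]
    congr 1
    have e : r + (k + 1) * (d - ℓ) = r + k * (d - ℓ) + (d - ℓ) := by ring
    rw [e]
    simp only [icc]
    rw [show r + k * (d - ℓ) + (d - ℓ) + 1 - 1 = (r + k * (d - ℓ) + 1 - 1) + (d - ℓ) by omega,
      ← List.range'_append_1]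
    congr 2 <;> omega

/-- `(W_{[ℓ₁+1:2ℓ₁]}, S_{ℓ+1→[ℓ₁+1:2ℓ₁]}, S_{{a_t : t ∈ [1:m]}→ℓ+1}, M^{(ℓ)})`. -/
def repairTuple (ℓ ℓ₁ m : ℕ) : List Atom :=
  Ws (icc (ℓ₁ + 1) (2 * ℓ₁)) ++ Sfrom (ℓ + 1) (icc (ℓ₁ + 1) (2 * ℓ₁))
    ++ Sto ((icc 1 m).map (aIdx ℓ ℓ₁)) (ℓ + 1) ++ Mup ℓ

lemma mem_repairTuple_map {ℓ ℓ₁ m : ℕ} {π : Equiv.Perm ℕ} {a : Atom} :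
    a ∈ (repairTuple ℓ ℓ₁ m).map (Atom.perm π) ↔
      (∃ i, (ℓ₁ + 1 ≤ i ∧ i ≤ 2 * ℓ₁) ∧ .W (π i) = a) ∨
      (∃ i, (ℓ₁ + 1 ≤ i ∧ i ≤ 2 * ℓ₁) ∧ .S (π (ℓ + 1)) (π i) = a) ∨
      (∃ t, (1 ≤ t ∧ t ≤ m) ∧ .S (π (aIdx ℓ ℓ₁ t)) (π (ℓ + 1)) = a) ∨ a ∈ Mup ℓ := by
  simp [repairTuple, Ws, Sfrom, Sto, Mup, MsL, mem_icc, Atom.perm]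

lemma Code.HL_repairTuple_le {C : Code Ω V d} (hsym : C.Symmetrical) (hregen : C.NodeRegen)
    {ℓ ℓ₁ : ℕ} (h : 2 * ℓ₁ ≤ ℓ) (hℓ : ℓ < d) :
    C.HL (repairTuple ℓ ℓ₁ (d - ℓ₁)) ≤ C.HL (U d ℓ₁ (ℓ₁ + 1) ++ Mup ℓ) := by
  obtain ⟨π, hπ, hπe⟩ := exists_perm_extending (Finset.Icc 1 (d + 1)) (Finset.Icc 1 (ℓ₁ + 1))
    (fun j => if j ≤ ℓ₁ then j + ℓ₁ else ℓ + 1) id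
    (by intro i hi; simp only [Finset.mem_Icc] at *; split_ifs <;> omega)
    (by intro i hi; simp only [Finset.mem_Icc, id] at *; omega)
    (by
      intro i hi j hj hij
      simp only [Finset.coe_Icc, Set.mem_Icc] at *
      split_ifs at hij <;> omega)
    (Set.injOn_id _)
  have hπW : ∀ i, ℓ₁ + 1 ≤ i → i ≤ 2 * ℓ₁ → π i = i - ℓ₁ := by
    intro i h1 h2
    have := hπe (i - ℓ₁) (Finset.mem_Icc.2 (by omega))
    rwa [if_pos (by omega), Nat.sub_add_cancel (by omega)] at this
  have hπℓ : π (ℓ + 1) = ℓ₁ + 1 := by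
    simpa using hπe (ℓ₁ + 1) (Finset.mem_Icc.2 (by omega))
  rw [← hsym π hπ (repairTuple ℓ ℓ₁ (d - ℓ₁))]
  refine C.HL_le fun ω ω' hE a ha => ?_
  have hU : ∀ a ∈ U d ℓ₁ (ℓ₁ + 1), C.Agree ω ω' a := fun a ha => hE a (by simp [ha])
  have hW : ∀ j, 1 ≤ j → j ≤ ℓ₁ + 1 → C.Agree ω ω' (.W j) :=
    fun j h1 h2 => hregen.agree_W_of_U (by omega) hU h1 h2
  rcases mem_repairTuple_map.1 ha with
    ⟨i, hi, rfl⟩ | ⟨i, hi, rfl⟩ | ⟨t, ht, rfl⟩ | hM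
  · rw [hπW i hi.1 hi.2]
    exact hW _ (by omega) (by omega)
  · rw [hπℓ, hπW i hi.1 hi.2]
    exact C.agree_S (Finset.mem_Icc.2 (by omega)) (Finset.mem_Icc.2 (by omega)) (by omega)
      (hW _ (by omega) le_rfl)
  · have hu := hπ _ (aIdx_mem_Icc h hℓ ht.1 ht.2)
    have hne : π (aIdx ℓ ℓ₁ t) ≠ ℓ₁ + 1 := by
      rw [← hπℓ]
      exact fun e => aIdx_ne ℓ ℓ₁ t h (π.injective e)
    rw [hπℓ]
    have hu' := Finset.mem_Icc.1 hu
    rcases lt_or_gt_of_ne hne with hlt | hgt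
    · exact C.agree_S hu (Finset.mem_Icc.2 (by omega)) hne (hW _ hu'.1 hlt.le)
    · exact hU _ (mem_U.2 (.inr ⟨ℓ₁ + 1, ⟨le_rfl, le_rfl⟩, _, ⟨hgt, hu'.2⟩, rfl⟩))
  · exact hE a (by simp [hM])

lemma Code.HL_U_succ_add_le {C : Code Ω V d} (hsym : C.Symmetrical) (hregen : C.NodeRegen)
    {ℓ ℓ₁ m : ℕ} (h : 2 * ℓ₁ ≤ ℓ) (hℓ : ℓ < d) (hm : m + (d - ℓ) ≤ d - ℓ₁) :
    C.HL (U d ℓ₁ (ℓ + 1) ++ Mup ℓ) + C.HL (repairTuple ℓ ℓ₁ m) ≤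
      C.HL (U d ℓ₁ ℓ ++ Mup ℓ) + C.HL (repairTuple ℓ ℓ₁ (m + (d - ℓ))) := by
  obtain ⟨π, hπ, hπe⟩ := exists_perm_extending (Finset.Icc 1 (d + 1))
    (Finset.Icc (ℓ₁ + 1) (2 * ℓ₁) ∪ Finset.Icc (ℓ + 1) (d + 1))
    (fun y => if y ≤ ℓ + 1 then y else aIdx ℓ ℓ₁ (m + (y - ℓ - 1))) id
    (by
      intro i hi
      simp only [Finset.mem_union, Finset.mem_Icc] at hi
      split_ifs
      · rw [Finset.mem_Icc]; omega
      · exact aIdx_mem_Icc h hℓ (by omega) (by omega))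
    (by intro i hi; simp only [Finset.mem_union, Finset.mem_Icc, id] at *; omega)
    (by
      intro i hi j hj hij
      simp only [Finset.coe_union, Finset.coe_Icc, Set.mem_union, Set.mem_Icc] at hi hj
      have hn := aIdx_ne ℓ ℓ₁
      have hn' := aIdx_notMem ℓ ℓ₁
      dsimp only at hij
      split_ifs at hij with h1 h2 h2
      · exact hij
      · have := hn (m + (j - ℓ - 1)) h
        have := hn' (m + (j - ℓ - 1))
        omega
      · have := hn (m + (i - ℓ - 1)) h
        have := hn' (m + (i - ℓ - 1))
        omega
      · have := (aIdx_strictMono ℓ ℓ₁).injective hij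
        omega)
    (Set.injOn_id _)
  have hπW : ∀ i, ℓ₁ + 1 ≤ i → i ≤ 2 * ℓ₁ → π i = i := by
    intro i h1 h2
    have := hπe i (by simp only [Finset.mem_union, Finset.mem_Icc]; omega)
    rwa [if_pos (by omega)] at this
  have hπℓ : π (ℓ + 1) = ℓ + 1 := by
    have := hπe (ℓ + 1) (by simp only [Finset.mem_union, Finset.mem_Icc]; omega)
    rwa [if_pos le_rfl] at this
  have hπa : ∀ i, ℓ + 2 ≤ i → i ≤ d + 1 → π (aIdx ℓ ℓ₁ (m + (i - ℓ - 1))) = i := by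
    intro i h1 h2
    have := hπe i (by simp only [Finset.mem_union, Finset.mem_Icc]; omega)
    rwa [if_neg (by omega)] at this
  rw [← hsym π hπ (repairTuple ℓ ℓ₁ m), ← hsym π hπ (repairTuple ℓ ℓ₁ (m + (d - ℓ)))]
  refine C.HL_add_le ?_ ?_ ?_
  · intro ω ω' h₁ h₂ a ha
    rcases List.mem_append.1 ha with ha | ha
    · rcases mem_U.1 ha with ⟨i, hi, rfl⟩ | ⟨j, hj, i, hi, rfl⟩
      · exact h₁ _ (List.mem_append_left _ (mem_U.2 (.inl ⟨i, hi, rfl⟩)))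
      · rcases hj.2.eq_or_lt with rfl | hlt
        · refine h₂ _ (mem_repairTuple_map.2 (.inr (.inr (.inl
            ⟨m + (i - ℓ - 1), by omega, ?_⟩))))
          rw [hπℓ, hπa i hi.1 hi.2]
        · exact h₁ _ (List.mem_append_left _
            (mem_U.2 (.inr ⟨j, ⟨hj.1, by omega⟩, i, hi, rfl⟩)))
    · exact h₁ a (List.mem_append_right _ ha)
  · intro ω ω' hE a ha
    have hU : ∀ a ∈ U d ℓ₁ ℓ, C.Agree ω ω' a := fun a ha => hE a (by simp [ha])
    have hW : ∀ j, 1 ≤ j → j ≤ ℓ → C.Agree ω ω' (.W j) :=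
      fun j h1 h2 => hregen.agree_W_of_U (by omega) hU h1 h2
    rcases mem_repairTuple_map.1 ha with
      ⟨i, hi, rfl⟩ | ⟨i, hi, rfl⟩ | ⟨t, ht, rfl⟩ | hM
    · rw [hπW i hi.1 hi.2]
      exact hW _ (by omega) (by omega)
    · rw [hπℓ, hπW i hi.1 hi.2]
      exact hU _ (mem_U.2 (.inr ⟨i, by omega, ℓ + 1, by omega, rfl⟩))
    · have hu := hπ _ (aIdx_mem_Icc h hℓ ht.1 (by omega))
      have hu' := Finset.mem_Icc.1 hu
      have hle : π (aIdx ℓ ℓ₁ t) ≤ ℓ := by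
        by_contra! hlt
        rcases Nat.eq_or_lt_of_le (Nat.succ_le_of_lt hlt) with he | he
        · exact aIdx_ne ℓ ℓ₁ t h (π.injective (by rw [hπℓ, ← he]))
        · have := (aIdx_strictMono ℓ ℓ₁).injective (π.injective (hπa _ he hu'.2))
          omega
      rw [hπℓ]
      exact C.agree_S hu (Finset.mem_Icc.2 (by omega)) (by omega) (hW _ hu'.1 hle)
    · exact hE a (by simp [hM])
  · intro ω ω' hE a ha
    refine hE a (mem_repairTuple_map.2 ?_)
    rcases mem_repairTuple_map.1 ha with hc | hc | ⟨t, ht, hc⟩ | hc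
    · exact .inl hc
    · exact .inr (.inl hc)
    · exact .inr (.inr (.inl ⟨t, by omega, hc⟩))
    · exact .inr (.inr (.inr hc))

theorem statement15 {Ω V : Type} [Fintype Ω] {d : ℕ} (hd : 2 ≤ d)
    {ℓ ℓ₁ s r : ℕ} (hℓ : ℓ ∈ Finset.Icc 1 (d - 1)) (hℓ₁ : ℓ₁ ∈ Finset.Icc 0 (ℓ / 2))
    (hs : 1 ≤ s) (hr : r ∈ Finset.Icc 1 (d - ℓ)) (hsr : d - ℓ₁ = s * (d - ℓ) + r)
    (C : Code Ω V d) (hsym : C.Symmetrical) (hregen : C.NodeRegen)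
    {p : ℕ} (hp : p ∈ Finset.Icc 1 s) :
    (p : ℝ) * C.CH (U d ℓ₁ ℓ) (Mup ℓ) + C.CH (U d ℓ₁ (ℓ₁ + 1)) (Mup ℓ)
      ≥ (p : ℝ) * C.CH (U d ℓ₁ (ℓ + 1)) (Mup ℓ)
        + C.CH (Ws (icc (ℓ₁ + 1) (2 * ℓ₁)) ++ Sfrom (ℓ + 1) (icc (ℓ₁ + 1) (2 * ℓ₁))
            ++ Sto (((List.range (s - p + 1)).map (tauL d ℓ ℓ₁ r)).flatten) (ℓ + 1))
          (Mup ℓ) := by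
  rw [Finset.mem_Icc] at hℓ hℓ₁ hr hp
  have h2 : 2 * ℓ₁ ≤ ℓ := by omega
  have hlt : ℓ < d := by omega
  have main : ∀ k ≤ s, (k : ℝ) * C.HL (U d ℓ₁ (ℓ + 1) ++ Mup ℓ) +
      C.HL (repairTuple ℓ ℓ₁ (r + (s - k) * (d - ℓ))) ≤
      (k : ℝ) * C.HL (U d ℓ₁ ℓ ++ Mup ℓ) + C.HL (U d ℓ₁ (ℓ₁ + 1) ++ Mup ℓ) := by
    intro k
    induction k with
    | zero =>
      intro _
      have hbase := Code.HL_repairTuple_le hsym hregen h2 hlt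
      rw [hsr, add_comm] at hbase
      simpa using hbase
    | succ k ih =>
      intro hk
      have e : r + (s - (k + 1)) * (d - ℓ) + (d - ℓ) = r + (s - k) * (d - ℓ) := by
        rw [show s - k = s - (k + 1) + 1 by omega]
        ring
      have hle : (s - k) * (d - ℓ) ≤ s * (d - ℓ) := Nat.mul_le_mul_right _ (Nat.sub_le _ _)
      have hstep := Code.HL_U_succ_add_le hsym hregen h2 hlt
        (m := r + (s - (k + 1)) * (d - ℓ)) (by omega)
      rw [e] at hstep
      have := ih (by omega)
      push_cast
      linarith
  have := main p hp.2
  rw [flatten_tauL]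
  simp only [Code.CH]
  simp only [repairTuple] at this
  linarith

end

end MDCSR
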